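/- Let α > 0 and 0 < r ≤ 1. Let T : L²(μ) → L²(μ) be a bounded linear operator such that T [e_k] = (1 + 4π² ∑_i k_i²)^{−α/2} · [e_k] for every k ∈ ℤⁿ, where [e_k] denotes the equivalence class of e_k in L²(μ), and assume the closed linear span of {[e_k] : k ∈ ℤⁿ} is all of L²(μ) (which holds by Stone–Weierstrass; thus T is the Bessel potential (I − Δ)^{−α/2} on the n-torus). Then T is r-nuclear if and only if α r > n. -/

import Mathlib

open MeasureTheory ENNReal NNReal Real

noncomputable section

/-- For `0 < r ≤ 1`, a bounded linear operator `T : E → F` between complex Banach spaces is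
`r`-nuclear if there are sequences `(x'_m)` of continuous functionals on `E` and `(y_m)` in `F`
with `T v = ∑ₘ x'_m(v) • y_m` for all `v` and `∑ₘ ‖x'_m‖^r ‖y_m‖^r < ∞`. -/
def IsRNuclear {E F : Type*} [NormedAddCommGroup E] [NormedSpace ℂ E]
    [NormedAddCommGroup F] [NormedSpace ℂ F] (r : ℝ) (T : E →L[ℂ] F) : Prop :=
  ∃ (x' : ℕ → (E →L[ℂ] ℂ)) (y : ℕ → F),
    (∀ v : E, HasSum (fun m => x' m v • y m) (T v)) ∧
    Summable (fun m => ‖x' m‖ ^ r * ‖y m‖ ^ r)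

/-- The `n`-torus `𝕋ⁿ = (ℝ/ℤ)ⁿ`; its `volume` measure is the product of the normalized
Haar measures of the circle factors, a probability measure. -/
abbrev Torus (n : ℕ) := Fin n → AddCircle (1 : ℝ)

/-- The character `e_k(x) = ∏ i, exp(2πi k_i x_i)` on the `n`-torus. -/
noncomputable def eK {n : ℕ} (k : Fin n → ℤ) (x : Torus n) : ℂ :=
  ∏ i, (fourier (k i) : C(AddCircle (1 : ℝ), ℂ)) (x i)

/-- The real part of the trace of a compression of an operator `∑ₘ x'ₘ ⊗ yₘ`, taken over a
finite-dimensional subspace on which the functionals `x'ₘ`, `m ∈ S`, vanish, is at most the sum of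
the remaining `‖x'ₘ‖ ‖yₘ‖`. -/
lemma sum_inner_re_le_of_hasSum {H : Type*} [NormedAddCommGroup H] [InnerProductSpace ℂ H]
    {T : H →L[ℂ] H} {x' : ℕ → (H →L[ℂ] ℂ)} {y : ℕ → H}
    (hxy : ∀ v, HasSum (fun m => x' m v • y m) (T v))
    (V : Submodule ℂ H) [FiniteDimensional ℂ V] {ι : Type*} [Fintype ι]
    (b : OrthonormalBasis ι ℂ V) (S : Finset ℕ) (hS : ∀ m ∈ S, ∀ v ∈ V, x' m v = 0) {c : ℝ}
    (hc : HasSum (fun m => if m ∈ S then 0 else ‖x' m‖ * ‖y m‖) c) :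
    ∑ j, (inner ℂ (b j : H) (T (b j))).re ≤ c := by
  have h1 : HasSum (fun m => ∑ j, x' m (b j) * inner ℂ (b j : H) (y m))
      (∑ j, inner ℂ (b j : H) (T (b j))) := by
    refine hasSum_sum fun j _ => ?_
    simpa [inner_smul_right] using (innerSL ℂ (b j : H)).hasSum (hxy (b j))
  have h2 : ∀ m, ∑ j, x' m (b j) * inner ℂ (b j : H) (y m) = x' m (V.starProjection (y m)) := by
    intro m
    rw [b.starProjection_eq_sum_rankOne]
    simp [mul_comm]
  have h3 : ‖∑ j, inner ℂ (b j : H) (T (b j))‖ ≤ c := by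
    refine h1.norm_le_of_bounded hc fun m => ?_
    rw [h2]
    split_ifs with hm
    · rw [hS m hm _ (Submodule.starProjection_apply_mem _ _), norm_zero]
    · refine (x' m).le_of_opNorm_le_of_le le_rfl ?_
      simpa using V.starProjection.le_of_opNorm_le V.starProjection_norm_le (y m)
  rw [← Complex.re_sum]
  exact (Complex.re_le_norm _).trans h3

/-- If `T = ∑ₘ x'ₘ ⊗ yₘ` has orthonormal eigenvectors `e k`, `k ∈ K`, with eigenvalues at least `β`,
then dropping the terms `m ∈ S` still leaves nuclear norm at least `(#K - #S) β`. -/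
lemma card_sub_card_mul_le_of_hasSum {H : Type*} [NormedAddCommGroup H] [InnerProductSpace ℂ H]
    {ι : Type*} {e : ι → H} (he : Orthonormal ℂ e) {T : H →L[ℂ] H} {l : ι → ℝ}
    (hT : ∀ k, T (e k) = (l k : ℂ) • e k) {x' : ℕ → (H →L[ℂ] ℂ)} {y : ℕ → H}
    (hxy : ∀ v, HasSum (fun m => x' m v • y m) (T v)) (K : Finset ι) (S : Finset ℕ) {β : ℝ}
    (hβ0 : 0 ≤ β) (hβ : ∀ k ∈ K, β ≤ l k) {c : ℝ}
    (hc : HasSum (fun m => if m ∈ S then 0 else ‖x' m‖ * ‖y m‖) c) :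
    ((K.card : ℝ) - S.card) * β ≤ c := by
  set W : Submodule ℂ H := Submodule.span ℂ (e '' K) with hW
  have hfinW : Module.finrank ℂ W = K.card := by
    have hli : LinearIndependent ℂ (fun k : K => e k) :=
      he.linearIndependent.comp _ Subtype.val_injective
    have := finrank_span_eq_card hli
    rw [Fintype.card_coe] at this
    have hrange : e '' K = Set.range fun k : K => e k := by ext; simp
    rw [hW, hrange, this]
  have hquad : ∀ v ∈ W, β * ‖v‖ ^ 2 ≤ (inner ℂ v (T v)).re := by
    intro v hv
    rw [hW, Submodule.mem_span_image_finset_iff_exists_fun'] at hv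
    obtain ⟨a, rfl⟩ := hv
    have hTv : T (∑ k ∈ K, a k • e k) = ∑ k ∈ K, (a k * l k) • e k := by
      simp [hT, smul_smul, -Complex.coe_smul, -Complex.real_smul]
    have hn : ‖∑ k ∈ K, a k • e k‖ ^ 2 = ∑ k ∈ K, ‖a k‖ ^ 2 := by
      rw [← inner_self_eq_norm_sq (𝕜 := ℂ), he.inner_sum, map_sum]
      exact Finset.sum_congr rfl fun k _ => by
        rw [← Complex.normSq_eq_conj_mul_self, Complex.normSq_eq_norm_sq]
        exact Complex.ofReal_re _
    rw [hTv, he.inner_sum, hn, Complex.re_sum, Finset.mul_sum]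
    refine Finset.sum_le_sum fun k hk => ?_
    rw [← mul_assoc, ← Complex.normSq_eq_conj_mul_self, Complex.normSq_eq_norm_sq,
      ← Complex.ofReal_mul, Complex.ofReal_re, mul_comm]
    exact mul_le_mul_of_nonneg_left (hβ k hk) (by positivity)
  let f : W →ₗ[ℂ] (S → ℂ) := LinearMap.pi fun m => (x' m : H →ₗ[ℂ] ℂ) ∘ₗ W.subtype
  let V : Submodule ℂ H := (LinearMap.ker f).map W.subtype
  have : FiniteDimensional ℂ W := FiniteDimensional.span_of_finite ℂ (K.finite_toSet.image e)
  have hVfin : Module.finrank ℂ V = Module.finrank ℂ (LinearMap.ker f) :=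
    (Submodule.equivMapOfInjective _ W.injective_subtype _).finrank_eq.symm
  have hdim : (K.card : ℝ) - S.card ≤ Module.finrank ℂ V := by
    have h1 := f.finrank_range_add_finrank_ker
    have h2 : Module.finrank ℂ (LinearMap.range f) ≤ S.card := by
      simpa using (LinearMap.range f).finrank_le
    rw [hfinW] at h1
    rw [hVfin, sub_le_iff_le_add]
    exact_mod_cast (by omega)
  have hVS : ∀ m ∈ S, ∀ v ∈ V, x' m v = 0 := by
    rintro m hm _ ⟨w, hw, rfl⟩
    exact congrFun (LinearMap.mem_ker.1 hw) ⟨m, hm⟩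
  have hVW : V ≤ W := Submodule.map_subtype_le _ _
  let b := stdOrthonormalBasis ℂ V
  calc ((K.card : ℝ) - S.card) * β ≤ Module.finrank ℂ V * β := by gcongr
    _ = ∑ _j : Fin (Module.finrank ℂ V), β := by simp
    _ ≤ ∑ j, (inner ℂ (b j : H) (T (b j))).re := Finset.sum_le_sum fun j _ => by
        have h := hquad (b j) (hVW (b j).2)
        have h1 : ‖(b j : H)‖ = 1 := b.orthonormal.1 j
        simpa [h1] using h
    _ ≤ c := sum_inner_re_le_of_hasSum hxy V b S hVS hc

/-- If `∑ aₘ ^ r` converges, its part over the `m` with `aₘ ≤ δ` tends to `0` as `δ → 0`. -/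
lemma tendsto_tsum_ite_le_rpow {a : ℕ → ℝ} (ha : ∀ m, 0 ≤ a m) {r : ℝ} (hr : 0 < r)
    (hs : Summable fun m => a m ^ r) :
    Filter.Tendsto (fun δ : ℝ => ∑' m, if a m ≤ δ then a m ^ r else 0)
      (nhdsWithin 0 (Set.Ioi 0)) (nhds 0) := by
  have hnn : ∀ m, 0 ≤ a m ^ r := fun m => Real.rpow_nonneg (ha m) r
  have h := tendsto_tsum_of_dominated_convergence (𝓕 := nhdsWithin (0 : ℝ) (Set.Ioi 0))
    (f := fun δ m => if a m ≤ δ then a m ^ r else 0) (g := fun _ => (0 : ℝ)) hs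
    (fun m => ?_) (Filter.Eventually.of_forall fun δ m => ?_)
  · simpa using h
  · rcases (ha m).eq_or_lt with h0 | h0
    · simp [← h0, Real.zero_rpow hr.ne']
    · refine tendsto_const_nhds.congr' ?_
      filter_upwards [nhdsWithin_le_nhds (Iio_mem_nhds h0)] with δ hδ
      rw [if_neg (not_le.2 hδ)]
  · split_ifs
    · rw [norm_of_nonneg (hnn m)]
    · simpa using hnn m

/-- The eigenvalues of an `r`-nuclear operator with respect to an orthonormal system satisfy
`l_N = o(N ^ (-1 / r))`. -/
lemma IsRNuclear.exists_eigenvalue_lt {H : Type*} [NormedAddCommGroup H] [InnerProductSpace ℂ H]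
    {ι : Type*} {e : ι → H} (he : Orthonormal ℂ e) {T : H →L[ℂ] H} {l : ι → ℝ}
    (hT : ∀ k, T (e k) = (l k : ℂ) • e k) {r : ℝ} (hr0 : 0 < r) (hr1 : r ≤ 1)
    (h : IsRNuclear r T) {ε : ℝ} (hε : 0 < ε) :
    ∀ᶠ N : ℕ in Filter.atTop, ∀ K : Finset ι, K.card = N →
      ∃ k ∈ K, l k < ε * (N : ℝ) ^ (-(1 / r)) := by
  obtain ⟨x', y, hxy, hs⟩ := h
  set a : ℕ → ℝ := fun m => ‖x' m‖ * ‖y m‖ with ha_def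
  have ha : ∀ m, 0 ≤ a m := fun m => by positivity
  replace hs : Summable fun m => a m ^ r := by
    simpa only [ha_def, Real.mul_rpow (norm_nonneg _) (norm_nonneg _)] using hs
  have hnn : ∀ m, 0 ≤ a m ^ r := fun m => Real.rpow_nonneg (ha m) r
  set C : ℝ := ∑' m, a m ^ r + 1 with hC
  have hCpos : 0 < C := by
    have : 0 ≤ ∑' m, a m ^ r := tsum_nonneg hnn
    linarith
  set A : ℝ := (2 * C) ^ (1 / r) with hA
  have hApos : 0 < A := by positivity
  have hAr : A ^ r = 2 * C := by
    rw [hA, ← Real.rpow_mul (by positivity), one_div_mul_cancel hr0.ne', Real.rpow_one]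
  have hδ : Filter.Tendsto (fun N : ℕ => A * (N : ℝ) ^ (-(1 / r))) Filter.atTop
      (nhdsWithin 0 (Set.Ioi 0)) := by
    refine tendsto_nhdsWithin_iff.2 ⟨?_, ?_⟩
    · simpa using ((tendsto_rpow_neg_atTop (one_div_pos.2 hr0)).comp
        tendsto_natCast_atTop_atTop).const_mul A
    · filter_upwards [Filter.eventually_gt_atTop 0] with N hN
      have : (0 : ℝ) < N := by exact_mod_cast hN
      exact Set.mem_Ioi.2 (by positivity)
  have hsmall : 0 < ε / (2 * A ^ (1 - r)) := by positivity
  filter_upwards [((tendsto_tsum_ite_le_rpow ha hr0 hs).comp hδ).eventually_lt_const hsmall,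
    Filter.eventually_gt_atTop 0] with N hN hN0 K hK
  have hNpos : (0 : ℝ) < N := by exact_mod_cast hN0
  by_contra! hcon
  simp only [Function.comp_apply] at hN
  set δ : ℝ := A * (N : ℝ) ^ (-(1 / r)) with hδ_def
  have hδpos : 0 < δ := by positivity
  have hδr : δ ^ r = 2 * C / N := by
    rw [hδ_def, Real.mul_rpow hApos.le (by positivity), hAr, ← Real.rpow_mul hNpos.le, neg_mul,
      one_div_mul_cancel hr0.ne', Real.rpow_neg_one, div_eq_mul_inv]
  have hfin : {m | δ < a m}.Finite := by
    have hev := hs.tendsto_cofinite_zero.eventually_lt_const (Real.rpow_pos_of_pos hδpos r)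
    refine (Filter.eventually_cofinite.1 hev).subset fun m hm => ?_
    simpa using Real.rpow_le_rpow hδpos.le (le_of_lt hm) hr0.le
  set S := hfin.toFinset with hS
  have hcard : (S.card : ℝ) ≤ N / 2 := by
    have h1 : (S.card : ℝ) * δ ^ r ≤ C := by
      calc (S.card : ℝ) * δ ^ r = ∑ _m ∈ S, δ ^ r := by simp
        _ ≤ ∑ m ∈ S, a m ^ r := Finset.sum_le_sum fun m hm =>
            Real.rpow_le_rpow hδpos.le (le_of_lt (by simpa [hS] using hm)) hr0.le
        _ ≤ ∑' m, a m ^ r := hs.sum_le_tsum _ fun m _ => hnn m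
        _ ≤ C := by linarith
    rw [hδr, mul_div_assoc', div_le_iff₀ hNpos] at h1
    nlinarith
  have hpt : ∀ m, (if m ∈ S then 0 else a m) ≤
      δ ^ (1 - r) * (if a m ≤ δ then a m ^ r else 0) := by
    intro m
    by_cases hm : a m ≤ δ
    · rw [if_neg (by simpa [hS] using hm), if_pos hm]
      calc a m = a m ^ (1 - r) * a m ^ r := by
            rw [← Real.rpow_add' (ha m) (by simp), sub_add_cancel, Real.rpow_one]
        _ ≤ δ ^ (1 - r) * a m ^ r := by
            gcongr
    · rw [if_pos (by simpa [hS] using hm), if_neg hm, mul_zero]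
  have hsum1 : Summable fun m => if a m ≤ δ then a m ^ r else 0 :=
    hs.of_nonneg_of_le (fun m => by split_ifs <;> simp [hnn]) fun m => by
      split_ifs <;> simp [hnn]
  have hsum2 : Summable fun m => if m ∈ S then 0 else a m :=
    (hsum1.mul_left (δ ^ (1 - r))).of_nonneg_of_le
      (fun m => by split_ifs <;> simp [ha]) hpt
  have htail : ∑' m, (if m ∈ S then 0 else a m) ≤
      δ ^ (1 - r) * ∑' m, (if a m ≤ δ then a m ^ r else 0) := by
    rw [← _root_.tsum_mul_left]
    exact hsum2.tsum_le_tsum hpt (hsum1.mul_left _)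
  have hmain := card_sub_card_mul_le_of_hasSum he hT hxy K S (by positivity) hcon hsum2.hasSum
  have hδ1 : δ ^ (1 - r) = A ^ (1 - r) * (N * (N : ℝ) ^ (-(1 / r))) := by
    rw [hδ_def, Real.mul_rpow hApos.le (by positivity), ← Real.rpow_mul hNpos.le]
    have hexp : -(1 / r) * (1 - r) = 1 + -(1 / r) := by field_simp; ring
    rw [hexp, Real.rpow_add hNpos, Real.rpow_one]
  have hlow : (N / 2 : ℝ) * (ε * (N : ℝ) ^ (-(1 / r))) ≤
      ((K.card : ℝ) - S.card) * (ε * (N : ℝ) ^ (-(1 / r))) := by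
    rw [hK]
    gcongr
    linarith
  have hlt := mul_lt_mul_of_pos_left hN (Real.rpow_pos_of_pos hδpos (1 - r))
  have heq : δ ^ (1 - r) * (ε / (2 * A ^ (1 - r))) =
      (N / 2 : ℝ) * (ε * (N : ℝ) ^ (-(1 / r))) := by
    rw [hδ1]
    have : A ^ (1 - r) ≠ 0 := by positivity
    field_simp
  linarith

/-- A diagonal operator in a Hilbert basis with eigenvalues in `ℓʳ` is `r`-nuclear. -/
lemma isRNuclear_of_summable_eigenvalues {H : Type*} [NormedAddCommGroup H]
    [InnerProductSpace ℂ H] {ι : Type*} [Denumerable ι] (b : HilbertBasis ι ℂ H)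
    {T : H →L[ℂ] H} {l : ι → ℝ} (hl : ∀ k, 0 ≤ l k) (hT : ∀ k, T (b k) = (l k : ℂ) • b k)
    {r : ℝ} (hs : Summable fun k => l k ^ r) : IsRNuclear r T := by
  let φ := (Denumerable.eqv ι).symm
  refine ⟨fun m => (l (φ m) : ℂ) • innerSL ℂ (b (φ m)), fun m => b (φ m), fun v => ?_, ?_⟩
  · have h := φ.hasSum_iff.2 (T.hasSum (b.hasSum_repr v))
    simpa [Function.comp_def, hT, smul_smul, b.repr_apply_apply, mul_comm,
      -Complex.coe_smul, -Complex.real_smul] using h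
  · have h := φ.summable_iff.2 hs
    simpa [Function.comp_def, norm_smul, b.orthonormal.1, abs_of_nonneg, hl] using h

lemma summable_norm_intCast_rpow {n : ℕ} {s : ℝ} (hs : s < -n) :
    Summable fun k : Fin n → ℤ => ‖fun i => (k i : ℝ)‖ ^ s := by
  let L := Submodule.span ℤ (Set.range (Pi.basisFun ℝ (Fin n)))
  have hrank : Module.finrank ℤ L = n := by
    rw [ZLattice.rank ℝ L]; simp
  have h := ZLattice.summable_norm_rpow L s (by rwa [hrank])
  have hmem : ∀ k : Fin n → ℤ, (fun i => (k i : ℝ)) ∈ L := fun k => by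
    rw [(Pi.basisFun ℝ (Fin n)).mem_span_iff_repr_mem ℤ]
    intro i
    simp
  refine h.comp_injective (i := fun k : Fin n → ℤ => (⟨fun i => (k i : ℝ), hmem k⟩ : L)) ?_
  intro k k' hk
  funext i
  have := congrFun (congrArg Subtype.val hk) i
  simpa using this

/-- The eigenvalue `(1 + 4π²|k|²) ^ (-α/2)` of the Bessel potential at `e_k`. -/
def besselEigenvalue {n : ℕ} (α : ℝ) (k : Fin n → ℤ) : ℝ :=
  (1 + 4 * π ^ 2 * ∑ i, ((k i : ℝ)) ^ 2) ^ (-(α / 2))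

lemma besselEigenvalue_nonneg {n : ℕ} (α : ℝ) (k : Fin n → ℤ) : 0 ≤ besselEigenvalue α k := by
  unfold besselEigenvalue; positivity

lemma summable_besselEigenvalue_rpow {n : ℕ} {α r : ℝ} (h : (n : ℝ) < α * r) :
    Summable fun k : Fin n → ℤ => besselEigenvalue α k ^ r := by
  refine Summable.of_norm_bounded_eventually (summable_norm_intCast_rpow (neg_lt_neg h)) ?_
  filter_upwards [(Set.finite_singleton (0 : Fin n → ℤ)).compl_mem_cofinite] with k hk
  have hk0 : (fun i => (k i : ℝ)) ≠ 0 := fun h0 =>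
    hk (funext fun i => by simpa using congrFun h0 i)
  have hpos : 0 < ‖fun i => (k i : ℝ)‖ := norm_pos_iff.2 hk0
  have hle : ‖fun i => (k i : ℝ)‖ ^ 2 ≤ 1 + 4 * π ^ 2 * ∑ i, ((k i : ℝ)) ^ 2 := by
    have h1 : ‖fun i => (k i : ℝ)‖ ≤ √(∑ i, ((k i : ℝ)) ^ 2) :=
      (pi_norm_le_iff_of_nonneg (sqrt_nonneg _)).2 fun i => abs_le_sqrt <|
        Finset.single_le_sum (f := fun i => (k i : ℝ) ^ 2) (fun _ _ => sq_nonneg _)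
          (Finset.mem_univ i)
    have h2 : 0 ≤ ∑ i, ((k i : ℝ)) ^ 2 := by positivity
    have h3 := (le_sqrt (norm_nonneg _) h2).1 h1
    nlinarith [pi_gt_three, mul_nonneg (show 0 ≤ 4 * π ^ 2 - 1 by nlinarith [pi_gt_three]) h2]
  rw [norm_of_nonneg (Real.rpow_nonneg (besselEigenvalue_nonneg α k) r), besselEigenvalue,
    ← Real.rpow_mul (by positivity)]
  calc _ ≤ (‖fun i => (k i : ℝ)‖ ^ 2) ^ (-(α / 2) * r) :=
        Real.rpow_le_rpow_of_nonpos (by positivity) hle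
          (by have : (0 : ℝ) ≤ n := n.cast_nonneg
              linarith)
    _ = ‖fun i => (k i : ℝ)‖ ^ (-(α * r)) := by
        rw [← Real.rpow_natCast, ← Real.rpow_mul hpos.le]
        congr 1
        push_cast
        ring

/-- On the box `[0, R)ⁿ` with `Rⁿ` lattice points the eigenvalues are at least `c R ^ (-α)`. -/
lemma le_besselEigenvalue {n : ℕ} {α : ℝ} (hα : 0 ≤ α) {R : ℕ} (hR : 1 ≤ R) {k : Fin n → ℤ}
    (hk : k ∈ Fintype.piFinset fun _ : Fin n => Finset.Ico (0 : ℤ) R) :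
    (1 + 4 * π ^ 2 * n) ^ (-(α / 2)) * (R : ℝ) ^ (-α) ≤ besselEigenvalue α k := by
  have hR' : (1 : ℝ) ≤ R := by exact_mod_cast hR
  have hRα : (R : ℝ) ^ (-α) = ((R : ℝ) ^ 2) ^ (-(α / 2)) := by
    rw [← Real.rpow_natCast, ← Real.rpow_mul (by positivity)]
    congr 1
    push_cast
    ring
  rw [hRα, ← Real.mul_rpow (by positivity) (by positivity), besselEigenvalue]
  refine Real.rpow_le_rpow_of_nonpos (by positivity) ?_ (by linarith)
  have hsum : ∑ i, ((k i : ℝ)) ^ 2 ≤ n * (R : ℝ) ^ 2 := by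
    calc ∑ i, ((k i : ℝ)) ^ 2 ≤ ∑ _i : Fin n, (R : ℝ) ^ 2 := Finset.sum_le_sum fun i _ => by
          have hi := Finset.mem_Ico.1 (Fintype.mem_piFinset.1 hk i)
          have h0 : (0 : ℝ) ≤ k i := by exact_mod_cast hi.1
          have h1 : (k i : ℝ) ≤ R := by exact_mod_cast hi.2.le
          gcongr
      _ = n * (R : ℝ) ^ 2 := by simp
  nlinarith [mul_le_mul_of_nonneg_left hsum (show 0 ≤ 4 * π ^ 2 by positivity)]

lemma continuous_eK {n : ℕ} (k : Fin n → ℤ) : Continuous (eK k) := by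
  unfold eK; fun_prop

/-- The class of `e_k` in `L²(𝕋ⁿ)`. -/
def eKLp {n : ℕ} (k : Fin n → ℤ) : Lp ℂ 2 (volume : Measure (Torus n)) :=
  ContinuousMap.toLp (E := ℂ) 2 volume ℂ ⟨eK k, continuous_eK k⟩

lemma coeFn_eKLp {n : ℕ} (k : Fin n → ℤ) : ⇑(eKLp k) =ᵐ[volume] eK k :=
  ContinuousMap.coeFn_toLp volume _

lemma integral_fourier_unitAddCircle (j : ℤ) :
    ∫ x : AddCircle (1 : ℝ), fourier j x = if j = 0 then 1 else 0 := by
  have h := orthonormal_iff_ite.1 (orthonormal_fourier (T := (1 : ℝ))) 0 j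
  rw [ContinuousMap.inner_toLp] at h
  rw [AddCircle.volume_eq_smul_haarAddCircle]
  simpa [eq_comm] using h

lemma orthonormal_eKLp {n : ℕ} : Orthonormal ℂ (eKLp (n := n)) := by
  rw [orthonormal_iff_ite]
  intro k k'
  have hmul : ∀ x : Torus n, eK k' x * (starRingEnd ℂ) (eK k x) =
      ∏ i, (fourier (k' i - k i) : C(AddCircle (1 : ℝ), ℂ)) (x i) := by
    intro x
    simp_rw [eK, map_prod, ← Finset.prod_mul_distrib, sub_eq_add_neg, fourier_add, fourier_neg]
  rw [eKLp, eKLp, ContinuousMap.inner_toLp]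
  simp only [ContinuousMap.coe_mk, hmul]
  rw [integral_fintype_prod_volume_eq_prod
    (fun i => ⇑(fourier (k' i - k i) : C(AddCircle (1 : ℝ), ℂ)))]
  simp only [integral_fourier_unitAddCircle, Finset.prod_ite_zero, sub_eq_zero, funext_iff,
    Finset.mem_univ, true_implies, Finset.prod_const_one, eq_comm]

/-- **`r`-nuclearity of Bessel potentials on the torus.** Let `α > 0`, `0 < r ≤ 1` and let
`T : L²(μ) → L²(μ)` satisfy `T[e_k] = (1 + 4π²∑ k_i²)^{-α/2} [e_k]` for all `k ∈ ℤⁿ`, where the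
closed span of the `[e_k]` is all of `L²(μ)`; thus `T = (I - Δ)^{-α/2}`. Then `T` is `r`-nuclear
iff `αr > n`. -/
theorem bessel_potential_rNuclear_iff (n : ℕ) (hn : 1 ≤ n)
    (α : ℝ) (hα : 0 < α) (r : ℝ) (hr0 : 0 < r) (hr1 : r ≤ 1)
    (T : Lp ℂ 2 (volume : Measure (Torus n)) →L[ℂ] Lp ℂ 2 (volume : Measure (Torus n)))
    (hT : ∀ (k : Fin n → ℤ) (g : Lp ℂ 2 (volume : Measure (Torus n))),
      ⇑g =ᵐ[volume] eK k →
      T g = ((((1 + 4 * π ^ 2 * ∑ i, ((k i : ℝ)) ^ 2) ^ (-(α / 2)) : ℝ)) : ℂ) • g)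
    (hspan : (Submodule.span ℂ {g : Lp ℂ 2 (volume : Measure (Torus n)) |
        ∃ k : Fin n → ℤ, ⇑g =ᵐ[volume] eK k}).topologicalClosure = ⊤) :
    IsRNuclear r T ↔ (n : ℝ) < α * r := by
  have hTe : ∀ k, T (eKLp k) = (besselEigenvalue α k : ℂ) • eKLp k := fun k =>
    hT k (eKLp k) (coeFn_eKLp k)
  constructor
  · intro h
    by_contra! hle
    set c : ℝ := (1 + 4 * π ^ 2 * n) ^ (-(α / 2))
    have hc : 0 < c := by positivity
    have hev := (tendsto_natCast_atTop_atTop (R := ℕ)).comp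
      (Filter.tendsto_pow_atTop (α := ℕ) (by omega : n ≠ 0)) |>.eventually
      (h.exists_eigenvalue_lt orthonormal_eKLp hTe hr0 hr1 hc)
    obtain ⟨R, hRev, hR⟩ := (hev.and (Filter.eventually_ge_atTop 1)).exists
    obtain ⟨k, hk, hlt⟩ := hRev (Fintype.piFinset fun _ : Fin n => Finset.Ico (0 : ℤ) R)
      (by simp)
    have hR' : (1 : ℝ) ≤ R := by exact_mod_cast hR
    refine absurd (le_besselEigenvalue hα.le hR hk) (not_le.2 (hlt.trans_le ?_))
    gcongr
    simp only [Function.comp_apply, Nat.cast_id, Nat.cast_pow]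
    rw [← Real.rpow_natCast, ← Real.rpow_mul (by positivity)]
    refine Real.rpow_le_rpow_of_exponent_le hR' ?_
    rw [mul_neg, mul_one_div, neg_le_neg_iff, le_div_iff₀ hr0]
    exact hle
  · intro h
    have : Nonempty (Fin n) := ⟨⟨0, hn⟩⟩
    let _ : Denumerable (Fin n → ℤ) := Denumerable.ofEncodableOfInfinite _
    have hdense : ⊤ ≤ (Submodule.span ℂ (Set.range (eKLp (n := n)))).topologicalClosure := by
      rw [← hspan]
      refine Submodule.topologicalClosure_mono (Submodule.span_mono ?_)
      rintro g ⟨k, hg⟩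
      exact ⟨k, Lp.ext ((coeFn_eKLp k).trans hg.symm)⟩
    let b := HilbertBasis.mk orthonormal_eKLp hdense
    refine isRNuclear_of_summable_eigenvalues b (besselEigenvalue_nonneg α) (fun k => ?_)
      (summable_besselEigenvalue_rpow h)
    simpa [b] using hTe k
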